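/- Suppose the uniform conditional mixing assumption holds: lim_{M→∞} limsup_{T→∞} E[(1/T) Σ_{k=1}^{T} ess sup_{u,u' ∈ 𝕌_0} |E[(ℓ̄_0^M(u) ∘ T^{−k}) · ℓ̄_0^M(u') | 𝒴_{−∞,0}]|] = 0. Then for every admissible strategy u and every ε > 0: P[L_T(u) − L* ≤ −ε] → 0 as T → ∞, where L* := E[ess inf_{u ∈ 𝕌_0} E[ℓ_0(u) | 𝒴_{−∞,0}]]. -/

import Mathlib

open MeasureTheory Filter Set
open scoped ENNReal Topology symmDiff

noncomputable section

namespace ErgodicDecisions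

variable {Ω U : Type*}

/-- The `ℤ`-indexed iterates of an invertible transformation `T` with inverse `S`:
`iter T S n = Tⁿ` for `n ≥ 0` and `iter T S (-n) = Sⁿ`. -/
def iter (T S : Ω → Ω) : ℤ → Ω → Ω
  | Int.ofNat n => T^[n]
  | Int.negSucc n => S^[n + 1]

variable {m0 : MeasurableSpace Ω} [mU : MeasurableSpace U]

/-- The observation σ-field `𝒴_{m,n} = ⋁_{k=m}^{n} T^{-k} 𝒴`. -/
def obsField (T S : Ω → Ω) (Y : MeasurableSpace Ω) (m n : ℤ) : MeasurableSpace Ω :=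
  ⨆ k ∈ Set.Icc m n, MeasurableSpace.comap (iter T S k) Y

/-- The observation σ-field `𝒴_{-∞,n} = ⋁_{k ≤ n} T^{-k} 𝒴`. -/
def obsFieldLE (T S : Ω → Ω) (Y : MeasurableSpace Ω) (n : ℤ) : MeasurableSpace Ω :=
  ⨆ k ∈ Set.Iic n, MeasurableSpace.comap (iter T S k) Y

/-- `𝕌_{m,n}`: the set of `𝒴_{m,n}`-measurable decision maps `Ω → U`. -/
def Umn (T S : Ω → Ω) (Y : MeasurableSpace Ω) (m n : ℤ) : Set (Ω → U) :=
  {v | Measurable[obsField T S Y m n] v}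

/-- `𝕌_n = ⋃_{m ≤ n} 𝕌_{m,n}`. -/
def Un (T S : Ω → Ω) (Y : MeasurableSpace Ω) (n : ℤ) : Set (Ω → U) :=
  ⋃ m ∈ Set.Iic n, Umn T S Y m n

/-- The loss at time `n` of the decision map `v`: `ℓ_n(v)(ω) = ℓ(v(ω), Tⁿω)`. -/
def lossAt (T S : Ω → Ω) (ℓ : U → Ω → ℝ) (n : ℤ) (v : Ω → U) (ω : Ω) : ℝ :=
  ℓ (v ω) (iter T S n ω)

/-- An admissible strategy: `u_k` is `𝒴_{0,k}`-measurable for every `k ≥ 1`. -/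
def Admissible (T S : Ω → Ω) (Y : MeasurableSpace Ω) (u : ℕ → Ω → U) : Prop :=
  ∀ k : ℕ, 1 ≤ k → u k ∈ Umn T S Y 0 (k : ℤ)

/-- The time-average loss `L_T(u) = T⁻¹ ∑_{k=1}^T ℓ_k(u_k)`. -/
def avgLoss (T S : Ω → Ω) (ℓ : U → Ω → ℝ) (u : ℕ → Ω → U) (n : ℕ) (ω : Ω) : ℝ :=
  (n : ℝ)⁻¹ * ∑ k ∈ Finset.Icc 1 n, lossAt T S ℓ (k : ℤ) (u k) ω

/-- `g` is an essential infimum (an a.e.-greatest lower bound among random variables)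
of the family `(f i)_{i ∈ S₀}` under `P`. -/
def IsEssInfFam {ι : Type*} (P : Measure Ω) (S₀ : Set ι) (f : ι → Ω → ℝ) (g : Ω → ℝ) : Prop :=
  Measurable[m0] g ∧ (∀ i ∈ S₀, ∀ᵐ ω ∂P, g ω ≤ f i ω) ∧
    ∀ h : Ω → ℝ, Measurable[m0] h → (∀ i ∈ S₀, ∀ᵐ ω ∂P, h ω ≤ f i ω) → ∀ᵐ ω ∂P, h ω ≤ g ω

/-- `g` is an essential supremum (an a.e.-least upper bound among random variables)
of the family `(f i)_{i ∈ S₀}` under `P`. -/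
def IsEssSupFam {ι : Type*} (P : Measure Ω) (S₀ : Set ι) (f : ι → Ω → ℝ) (g : Ω → ℝ) : Prop :=
  Measurable[m0] g ∧ (∀ i ∈ S₀, ∀ᵐ ω ∂P, f i ω ≤ g ω) ∧
    ∀ h : Ω → ℝ, Measurable[m0] h → (∀ i ∈ S₀, ∀ᵐ ω ∂P, f i ω ≤ h ω) → ∀ᵐ ω ∂P, g ω ≤ h ω

/-- A mean-optimal strategy in the sense of Lemma 2.5 of the paper:
`E[ℓ_k(ũ_k)|𝒴_{0,k}] ≤ ess inf_{u ∈ 𝕌_{0,k}} E[ℓ_k(u)|𝒴_{0,k}] + 1/k` a.s. for all `k ≥ 1`. -/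
def MeanOptimalStrategy (P : Measure Ω) (T S : Ω → Ω) (Y : MeasurableSpace Ω)
    (ℓ : U → Ω → ℝ) (ut : ℕ → Ω → U) : Prop :=
  Admissible T S Y ut ∧
    ∀ k : ℕ, 1 ≤ k → ∃ g : Ω → ℝ,
      IsEssInfFam P (Umn T S Y 0 (k : ℤ))
        (fun v => P[lossAt T S ℓ (k : ℤ) v | obsField T S Y 0 (k : ℤ)]) g ∧
      ∀ᵐ ω ∂P, (P[lossAt T S ℓ (k : ℤ) (ut k) | obsField T S Y 0 (k : ℤ)]) ω ≤ g ω + (k : ℝ)⁻¹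

/-- Pathwise optimality (Definition 2.2). -/
def PathwiseOptimal (P : Measure Ω) (T S : Ω → Ω) (Y : MeasurableSpace Ω)
    (ℓ : U → Ω → ℝ) (us : ℕ → Ω → U) : Prop :=
  Admissible T S Y us ∧
    ∀ u : ℕ → Ω → U, Admissible T S Y u →
      ∀ᵐ ω ∂P,
        0 ≤ Filter.liminf (fun n : ℕ => avgLoss T S ℓ u n ω - avgLoss T S ℓ us n ω) atTop

/-- Weak pathwise optimality (Definition 2.3). -/
def WeaklyPathwiseOptimal (P : Measure Ω) (T S : Ω → Ω) (Y : MeasurableSpace Ω)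
    (ℓ : U → Ω → ℝ) (us : ℕ → Ω → U) : Prop :=
  Admissible T S Y us ∧
    ∀ u : ℕ → Ω → U, Admissible T S Y u → ∀ ε : ℝ, 0 < ε →
      Tendsto (fun n : ℕ => P {ω | -ε ≤ avgLoss T S ℓ u n ω - avgLoss T S ℓ us n ω})
        atTop (𝓝 1)

/-- Mean optimality (Definition 2.4). -/
def MeanOptimal (P : Measure Ω) (T S : Ω → Ω) (Y : MeasurableSpace Ω)
    (ℓ : U → Ω → ℝ) (us : ℕ → Ω → U) : Prop :=
  Admissible T S Y us ∧
    ∀ u : ℕ → Ω → U, Admissible T S Y u →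
      0 ≤ Filter.liminf
        (fun n : ℕ => (∫ ω, avgLoss T S ℓ u n ω ∂P) - ∫ ω, avgLoss T S ℓ us n ω ∂P) atTop

/-- Two σ-fields on `Ω` agree modulo `P`-null sets. -/
def EqModP (P : Measure Ω) (m₁ m₂ : MeasurableSpace Ω) : Prop :=
  (∀ A : Set Ω, MeasurableSet[m₁] A → ∃ B : Set Ω, MeasurableSet[m₂] B ∧ P (A ∆ B) = 0) ∧
    ∀ A : Set Ω, MeasurableSet[m₂] A → ∃ B : Set Ω, MeasurableSet[m₁] B ∧ P (A ∆ B) = 0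

/-- Conditional K-automorphism relative to `Z` (Definition 1.4); `S` is the inverse of `T`,
so that `T^{-k}𝒳 = comap T^k 𝒳` and `T^{k}𝒳 = comap S^k 𝒳`. -/
def CondK (P : Measure Ω) (T S : Ω → Ω) (Z : MeasurableSpace Ω) : Prop :=
  ∃ X : MeasurableSpace Ω, X ≤ m0 ∧
    X ≤ MeasurableSpace.comap T X ∧
    EqModP P (⨆ k : ℕ, MeasurableSpace.comap (T^[k + 1]) X) m0 ∧
    EqModP P (⨅ k : ℕ, Z ⊔ MeasurableSpace.comap (S^[k + 1]) X) Z

/-- Conditional weak mixing relative to `Z` (Definition 1.3); `S` is the inverse of `T`,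
so that `T^k B = (S^[k])⁻¹ B`. -/
def CondWeakMixing (P : Measure Ω) (S : Ω → Ω) (Z : MeasurableSpace Ω) : Prop :=
  ∀ A B : Set Ω, MeasurableSet[m0] A → MeasurableSet[m0] B →
    Tendsto
      (fun n : ℕ => ∫ ω,
        (n : ℝ)⁻¹ * ∑ k ∈ Finset.Icc 1 n,
          |(P[(A ∩ S^[k] ⁻¹' B).indicator (fun _ => (1 : ℝ)) | Z]) ω -
            (P[A.indicator (fun _ => (1 : ℝ)) | Z]) ω *
              (P[(S^[k] ⁻¹' B).indicator (fun _ => (1 : ℝ)) | Z]) ω| ∂P)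
      atTop (𝓝 0)

/-- The tail σ-field `⋂_{k≥1} (𝒴_{-∞,0} ∨ T^k 𝒳)`. -/
def tailField (T S : Ω → Ω) (Y X : MeasurableSpace Ω) : MeasurableSpace Ω :=
  ⨅ k : ℕ, obsFieldLE T S Y 0 ⊔ MeasurableSpace.comap (S^[k + 1]) X

/-- The truncated loss `ℓ_0(v)·1_{Λ ≤ M}`. -/
def truncLoss (ℓ : U → Ω → ℝ) (Λ : Ω → ℝ) (M : ℝ) (v : Ω → U) (ω : Ω) : ℝ :=
  if Λ ω ≤ M then ℓ (v ω) ω else 0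

/-- `ℓ̄_0^M(v) = ℓ_0(v)·1_{Λ≤M} − E[ℓ_0(v)·1_{Λ≤M} | 𝒴_{-∞,0}]`. -/
def barLoss (P : Measure Ω) (T S : Ω → Ω) (Y : MeasurableSpace Ω)
    (ℓ : U → Ω → ℝ) (Λ : Ω → ℝ) (M : ℝ) (v : Ω → U) (ω : Ω) : ℝ :=
  truncLoss ℓ Λ M v ω - (P[truncLoss ℓ Λ M v | obsFieldLE T S Y 0]) ω

/-- The uniform conditional mixing assumption of Theorem 2.12:
`lim_{M→∞} limsup_{T→∞} E[(1/T)∑_{k=1}^T ess sup_{u,u'∈𝕌₀}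
|E[(ℓ̄₀^M(u)∘T^{-k})·ℓ̄₀^M(u')|𝒴_{-∞,0}]|] = 0`. -/
def UniformCondMixing (P : Measure Ω) (T S : Ω → Ω) (Y : MeasurableSpace Ω)
    (ℓ : U → Ω → ℝ) (Λ : Ω → ℝ) : Prop :=
  ∃ G : ℝ → ℕ → Ω → ℝ,
    (∀ (M : ℝ) (k : ℕ),
      IsEssSupFam P ((Un T S Y 0) ×ˢ (Un T S Y 0))
        (fun p ω =>
          |(P[(fun ω' => barLoss P T S Y ℓ Λ M p.1 (S^[k] ω') *
                barLoss P T S Y ℓ Λ M p.2 ω') | obsFieldLE T S Y 0]) ω|)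
        (G M k)) ∧
    Tendsto
      (fun M : ℝ =>
        Filter.limsup
          (fun n : ℕ => ∫ ω, (n : ℝ)⁻¹ * ∑ k ∈ Finset.Icc 1 n, G M k ω ∂P) atTop)
      atTop (𝓝 0)

/-- Equimeasurability of the loss (Definition 3.1): for every `ε > 0` there is a set of
probability at least `1-ε` on which the family `{ℓ(u,·) : u ∈ U}` is totally bounded
in `L^∞(P)`. -/
def Equimeasurable (P : Measure Ω) (ℓ : U → Ω → ℝ) : Prop :=
  ∀ ε : ℝ, 0 < ε → ∃ Ωε : Set Ω, MeasurableSet[m0] Ωε ∧ 1 - ENNReal.ofReal ε ≤ P Ωε ∧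
    ∀ δ : ℝ, 0 < δ → ∃ 𝒩 : Finset (Ω → ℝ), ∀ u : U, ∃ f ∈ 𝒩,
      eLpNorm (fun ω => Ωε.indicator (ℓ u) ω - f ω) ⊤ P ≤ ENNReal.ofReal δ


lemma avg_int {P : Measure Ω} {T : Ω → Ω} (hT : MeasurePreserving T P P) {f : Ω → ℝ}
    (hf : Integrable f P) (n : ℕ) :
    Integrable (fun ω => (n : ℝ)⁻¹ * ∑ i ∈ Finset.range n, f (T^[i] ω)) P :=
  (integrable_finsetSum _ fun i _ => (hT.iterate i).integrable_comp_of_integrable hf).const_mul _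

lemma mp_integral {P : Measure Ω} {T : Ω → Ω} (hT : MeasurePreserving T P P) {f : Ω → ℝ}
    (hf : AEStronglyMeasurable f P) : ∫ ω, f (T ω) ∂P = ∫ ω, f ω ∂P := by
  have h := integral_map (μ := P) (φ := T) hT.aemeasurable (f := f) (by rwa [hT.map_eq])
  rw [hT.map_eq] at h
  exact h.symm

lemma avg_L1 {P : Measure Ω} {T : Ω → Ω} (hT : MeasurePreserving T P P) {f : Ω → ℝ}
    (hf : Integrable f P) (n : ℕ) :
    ∫ ω, |(n : ℝ)⁻¹ * ∑ i ∈ Finset.range n, f (T^[i] ω)| ∂P ≤ ∫ ω, |f ω| ∂P := by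
  have hi : ∀ i, Integrable (fun ω => |f (T^[i] ω)|) P := fun i =>
    ((hT.iterate i).integrable_comp_of_integrable hf).abs
  have h1 : ∫ ω, |(n : ℝ)⁻¹ * ∑ i ∈ Finset.range n, f (T^[i] ω)| ∂P
      ≤ ∫ ω, (n : ℝ)⁻¹ * ∑ i ∈ Finset.range n, |f (T^[i] ω)| ∂P := by
    refine integral_mono (avg_int hT hf n).abs
      ((integrable_finsetSum _ fun i _ => hi i).const_mul _) fun ω => ?_
    simp only [abs_mul, abs_inv, Nat.abs_cast]
    gcongr
    exact Finset.abs_sum_le_sum_abs _ _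
  refine h1.trans ?_
  rw [integral_const_mul, integral_finsetSum _ (fun i _ => hi i)]
  have : ∀ i, ∫ ω, |f (T^[i] ω)| ∂P = ∫ ω, |f ω| ∂P := fun i =>
    mp_integral (f := fun ω => |f ω|) (hT.iterate i) hf.abs.aestronglyMeasurable
  simp only [this, Finset.sum_const, Finset.card_range, nsmul_eq_mul]
  rcases Nat.eq_zero_or_pos n with rfl | hn
  · simpa using integral_nonneg (fun ω => abs_nonneg (f ω))
  · have : (n : ℝ) ≠ 0 := by positivity
    rw [← mul_assoc, inv_mul_cancel₀ this, one_mul]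

lemma avg_integral {P : Measure Ω} {T : Ω → Ω} (hT : MeasurePreserving T P P) {f : Ω → ℝ}
    (hf : Integrable f P) (n : ℕ) (hn : 0 < n) :
    ∫ ω, (n : ℝ)⁻¹ * ∑ i ∈ Finset.range n, f (T^[i] ω) ∂P = ∫ ω, f ω ∂P := by
  have hi : ∀ i, Integrable (fun ω => f (T^[i] ω)) P := fun i =>
    (hT.iterate i).integrable_comp_of_integrable hf
  rw [integral_const_mul, integral_finsetSum _ (fun i _ => hi i)]
  have : ∀ i, ∫ ω, f (T^[i] ω) ∂P = ∫ ω, f ω ∂P := fun i =>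
    mp_integral (hT.iterate i) hf.aestronglyMeasurable
  simp only [this, Finset.sum_const, Finset.card_range, nsmul_eq_mul]
  have : (n : ℝ) ≠ 0 := by positivity
  rw [← mul_assoc, inv_mul_cancel₀ this, one_mul]

lemma met2 {P : Measure Ω} [IsProbabilityMeasure P] {T : Ω → Ω} (hT : Ergodic T P) {f : Ω → ℝ}
    (hf : MemLp f 2 P) :
    Tendsto (fun n : ℕ => ∫ ω, |(n : ℝ)⁻¹ * ∑ i ∈ Finset.range n, f (T^[i] ω) - ∫ x, f x ∂P| ∂P)
      atTop (𝓝 0) := by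
  have hmp := hT.toMeasurePreserving
  have hfi : Integrable f P := hf.integrable one_le_two
  let K : Lp ℝ 2 P →L[ℝ] Lp ℝ 2 P :=
    (Lp.compMeasurePreservingₗᵢ ℝ T hmp).toContinuousLinearMap
  have hK : ‖K‖ ≤ 1 := LinearIsometry.norm_toContinuousLinearMap_le _
  have hKapp : ∀ x, K x = Lp.compMeasurePreserving T hmp x := fun x => rfl
  obtain ⟨p, hfix, hlim⟩ : ∃ p : Lp ℝ 2 P, K p = p ∧
      Tendsto (birkhoffAverage ℝ K _root_.id · (hf.toLp f)) atTop (𝓝 p) :=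
    ⟨_, Subtype.property (p := fun x => K x = x) _,
      K.tendsto_birkhoffAverage_orthogonalProjection hK (hf.toLp f)⟩
  obtain ⟨c, hc⟩ : ∃ c, (p : Lp ℝ 2 P) =ᵐ[P] Function.const Ω c := by
    refine hT.ae_eq_const_of_ae_eq_comp_ae (Lp.aestronglyMeasurable _) ?_
    have h1 := Lp.coeFn_compMeasurePreserving (p : Lp ℝ 2 P) hmp
    rw [← hKapp, hfix] at h1
    exact h1.symm
  have hiter : ∀ i : ℕ, ((K^[i] (hf.toLp f) : Lp ℝ 2 P) : Ω → ℝ) =ᵐ[P] fun ω => f (T^[i] ω) := by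
    intro i
    have : K^[i] (hf.toLp f) = Lp.compMeasurePreserving (T^[i]) (hmp.iterate i) (hf.toLp f) := by
      exact congrFun (Lp.compMeasurePreserving_iterate (E := ℝ) (p := 2) hmp i) _
    rw [this, Lp.toLp_compMeasurePreserving]
    exact MemLp.coeFn_toLp _
  have havg : ∀ n : ℕ, ((birkhoffAverage ℝ K _root_.id n (hf.toLp f) : Lp ℝ 2 P) : Ω → ℝ)
      =ᵐ[P] fun ω => (n : ℝ)⁻¹ * ∑ i ∈ Finset.range n, f (T^[i] ω) := by
    intro n
    simp only [birkhoffAverage, birkhoffSum, id]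
    refine (Lp.coeFn_smul _ _).trans ?_
    have h2 : ((∑ i ∈ Finset.range n, K^[i] (hf.toLp f) : Lp ℝ 2 P) : Ω → ℝ) =ᵐ[P]
        fun ω => ∑ i ∈ Finset.range n, f (T^[i] ω) := by
      induction n with
      | zero => simp only [Finset.range_zero, Finset.sum_empty]; exact Lp.coeFn_zero ℝ 2 P
      | succ n ih =>
        rw [Finset.sum_range_succ]
        filter_upwards [Lp.coeFn_add (∑ i ∈ Finset.range n, K^[i] (hf.toLp f)) (K^[n] (hf.toLp f)),
          ih, hiter n] with ω h1 h2 h3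
        rw [h1, Pi.add_apply, h2, h3, Finset.sum_range_succ]
    filter_upwards [h2] with ω h
    rw [Pi.smul_apply, smul_eq_mul, h]
  have hL : Tendsto (fun n : ℕ => ∫ ω, |(n : ℝ)⁻¹ * ∑ i ∈ Finset.range n, f (T^[i] ω) - c| ∂P)
      atTop (𝓝 0) := by
    have hn := (tendsto_iff_norm_sub_tendsto_zero.1 hlim)
    refine squeeze_zero (fun n => integral_nonneg fun _ => abs_nonneg _) (fun n => ?_) hn
    set x : Lp ℝ 2 P := birkhoffAverage ℝ K _root_.id n (hf.toLp f) - (p : Lp ℝ 2 P)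
    have hx : (x : Ω → ℝ) =ᵐ[P] fun ω => (n : ℝ)⁻¹ * ∑ i ∈ Finset.range n, f (T^[i] ω) - c := by
      filter_upwards [Lp.coeFn_sub (birkhoffAverage ℝ K _root_.id n (hf.toLp f)) (p : Lp ℝ 2 P),
        havg n, hc] with ω h1 h2 h3
      rw [h1, Pi.sub_apply, h2, h3]; rfl
    have h1 : ∫ ω, |(n : ℝ)⁻¹ * ∑ i ∈ Finset.range n, f (T^[i] ω) - c| ∂P = ∫ ω, ‖x ω‖ ∂P := by
      refine integral_congr_ae ?_
      filter_upwards [hx] with ω h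
      rw [h, Real.norm_eq_abs]
    rw [h1, integral_norm_eq_lintegral_enorm (Lp.aestronglyMeasurable _), Lp.norm_def,
      ← eLpNorm_one_eq_lintegral_enorm]
    exact ENNReal.toReal_mono (Lp.eLpNorm_ne_top _)
      (eLpNorm_le_eLpNorm_of_exponent_le one_le_two (Lp.aestronglyMeasurable _))
  have hcf : c = ∫ x, f x ∂P := by
    have h0 : Tendsto (fun n : ℕ => |∫ x, f x ∂P - c|) atTop (𝓝 0) := by
      refine squeeze_zero' (Eventually.of_forall fun n => abs_nonneg _) ?_ hL
      filter_upwards [eventually_gt_atTop 0] with n hn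
      have : ∫ x, f x ∂P - c =
          ∫ ω, ((n : ℝ)⁻¹ * ∑ i ∈ Finset.range n, f (T^[i] ω) - c) ∂P := by
        rw [integral_sub (avg_int hmp hfi n) (integrable_const _), avg_integral hmp hfi n hn]
        simp
      rw [this]
      exact abs_integral_le_integral_abs
    have := tendsto_nhds_unique h0 tendsto_const_nhds
    have := abs_eq_zero.1 this.symm
    linarith
  rw [← hcf]; exact hL

lemma met1 {P : Measure Ω} [IsProbabilityMeasure P] {T : Ω → Ω} (hT : Ergodic T P) {f : Ω → ℝ}
    (hf : Integrable f P) :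
    Tendsto (fun n : ℕ => ∫ ω, |(n : ℝ)⁻¹ * ∑ i ∈ Finset.range n, f (T^[i] ω) - ∫ x, f x ∂P| ∂P)
      atTop (𝓝 0) := by
  have hmp := hT.toMeasurePreserving
  rw [Metric.tendsto_atTop]
  intro ε hε
  obtain ⟨h, hh, hhm⟩ := (memLp_one_iff_integrable.2 hf).exists_simpleFunc_eLpNorm_sub_lt
    ENNReal.one_ne_top (ε := ENNReal.ofReal (ε / 3)) (by simpa using hε)
  have hhi : Integrable h P := memLp_one_iff_integrable.1 hhm
  have hd : ∫ ω, |f ω - h ω| ∂P < ε / 3 := by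
    have e1 : ∫ ω, |f ω - h ω| ∂P = (eLpNorm (f - (h : Ω → ℝ)) 1 P).toReal := by
      rw [eLpNorm_one_eq_lintegral_enorm,
        ← integral_norm_eq_lintegral_enorm (hf.sub hhi).aestronglyMeasurable]
      rfl
    rw [e1]
    exact (ENNReal.lt_ofReal_iff_toReal_lt hh.ne_top).1 hh
  have h2 := met2 hT (SimpleFunc.memLp_of_isFiniteMeasure h 2 P)
  obtain ⟨N, hN⟩ := Metric.tendsto_atTop.1 h2 (ε / 3) (by linarith)
  refine ⟨N, fun n hn => ?_⟩
  have h3 := hN n hn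
  rw [Real.dist_eq, sub_zero, abs_of_nonneg (integral_nonneg fun _ => abs_nonneg _)] at h3 ⊢
  have hA := avg_L1 hmp (hf.sub hhi) n
  have hAi := avg_int hmp (hf.sub hhi) n
  have hBi := (avg_int hmp hhi n).sub (integrable_const (∫ x, h x ∂P))
  have hAf := (avg_int hmp hf n).sub (integrable_const (∫ x, f x ∂P))
  have hc : |∫ x, h x ∂P - ∫ x, f x ∂P| ≤ ∫ ω, |f ω - h ω| ∂P := by
    rw [abs_sub_comm, ← integral_sub hf hhi]
    exact abs_integral_le_integral_abs
  have key : ∫ ω, |(n : ℝ)⁻¹ * ∑ i ∈ Finset.range n, f (T^[i] ω) - ∫ x, f x ∂P| ∂P ≤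
      ∫ ω, (|(n : ℝ)⁻¹ * ∑ i ∈ Finset.range n, (f - (h : Ω → ℝ)) (T^[i] ω)| +
        |(n : ℝ)⁻¹ * ∑ i ∈ Finset.range n, h (T^[i] ω) - ∫ x, h x ∂P| +
        |∫ x, h x ∂P - ∫ x, f x ∂P|) ∂P := by
    refine integral_mono hAf.abs ((hAi.abs.add hBi.abs).add (integrable_const _)) fun ω => ?_
    refine le_trans (le_of_eq ?_) (abs_add_three _ _ _)
    congr 1
    simp only [Pi.sub_apply, Finset.sum_sub_distrib]
    ring
  have hAa : Integrable (fun ω => |(n : ℝ)⁻¹ * ∑ i ∈ Finset.range n, (f - (h : Ω → ℝ)) (T^[i] ω)|) P := hAi.abs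
  have hBa : Integrable
    (fun ω => |(n : ℝ)⁻¹ * ∑ i ∈ Finset.range n, h (T^[i] ω) - ∫ x, h x ∂P|) P := hBi.abs
  have hABa : Integrable (fun ω => |(n : ℝ)⁻¹ * ∑ i ∈ Finset.range n, (f - (h : Ω → ℝ)) (T^[i] ω)| +
    |(n : ℝ)⁻¹ * ∑ i ∈ Finset.range n, h (T^[i] ω) - ∫ x, h x ∂P|) P := hAa.add hBa
  rw [integral_add hABa (integrable_const _), integral_add hAa hBa] at key
  simp only [integral_const, probReal_univ, one_smul] at key
  simp only [Pi.sub_apply] at hA key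
  linarith

/-- second moment bound -/
lemma second_moment {P : Measure Ω} [IsProbabilityMeasure P] (X : ℕ → Ω → ℝ) (C : ℝ)
    (hm : ∀ k, AEStronglyMeasurable (X k) P) (hb : ∀ k, ∀ᵐ ω ∂P, |X k ω| ≤ C)
    (c : ℕ → ℝ) (hc : ∀ k, 0 ≤ c k)
    (hX : ∀ j k, 1 ≤ j → j < k → ∫ ω, X j ω * X k ω ∂P ≤ c (k - j)) (n : ℕ) :
    ∫ ω, (∑ k ∈ Finset.Icc 1 n, X k ω) ^ 2 ∂P ≤
      n * C ^ 2 + 2 * (n * ∑ i ∈ Finset.Icc 1 n, c i) := by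
  have hL : ∀ k, MemLp (X k) 2 P := fun k => MemLp.of_bound (hm k) C (by simpa using hb k)
  have hS : ∀ n, MemLp (fun ω => ∑ k ∈ Finset.Icc 1 n, X k ω) 2 P := fun n =>
    memLp_finsetSum _ fun k _ => hL k
  induction n with
  | zero => simp
  | succ n ih =>
    have e : ∀ ω, (∑ k ∈ Finset.Icc 1 (n + 1), X k ω) ^ 2 =
        ((∑ k ∈ Finset.Icc 1 n, X k ω) ^ 2 +
          2 * ((∑ k ∈ Finset.Icc 1 n, X k ω * X (n + 1) ω))) + X (n + 1) ω ^ 2 := by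
      intro ω
      rw [Finset.sum_Icc_succ_top (by omega), ← Finset.sum_mul]; ring
    have hp : ∀ j k, Integrable (fun ω => X j ω * X k ω) P := fun j k => (hL j).integrable_mul (hL k)
    have hps : Integrable (fun ω => ∑ k ∈ Finset.Icc 1 n, X k ω * X (n + 1) ω) P :=
      integrable_finsetSum _ fun k _ => hp k _
    simp only [e]
    have hss : Integrable (fun ω => (∑ k ∈ Finset.Icc 1 n, X k ω) ^ 2 +
          2 * ((∑ k ∈ Finset.Icc 1 n, X k ω * X (n + 1) ω))) P :=
      (hS n).integrable_sq.add (hps.const_mul 2)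
    rw [integral_add hss (hL _).integrable_sq,
      integral_add (hS n).integrable_sq (hps.const_mul 2), integral_const_mul,
      integral_finsetSum _ fun k _ => hp k _]
    have h1 : ∑ k ∈ Finset.Icc 1 n, ∫ ω, X k ω * X (n + 1) ω ∂P ≤ ∑ i ∈ Finset.Icc 1 n, c i := by
      calc _ ≤ ∑ k ∈ Finset.Icc 1 n, c (n + 1 - k) := Finset.sum_le_sum fun k hk => by
            rw [Finset.mem_Icc] at hk
            exact hX k (n + 1) hk.1 (by omega)
        _ = _ := by
            refine Finset.sum_nbij' (fun k => n + 1 - k) (fun k => n + 1 - k) ?_ ?_ ?_ ?_ ?_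
            all_goals simp only [Finset.mem_Icc]
            all_goals intro a ha
            all_goals first | omega | trivial
    have h2 : ∫ ω, X (n + 1) ω ^ 2 ∂P ≤ C ^ 2 := by
      have : ∫ ω, X (n + 1) ω ^ 2 ∂P ≤ ∫ ω, C ^ 2 ∂P := by
        refine integral_mono_ae (hL _).integrable_sq (integrable_const _) ?_
        filter_upwards [hb (n + 1)] with ω h
        exact sq_le_sq' (abs_le.1 h).1 (abs_le.1 h).2
      simpa using this
    have h3 : ∑ i ∈ Finset.Icc 1 n, c i ≤ ∑ i ∈ Finset.Icc 1 (n + 1), c i := by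
      rw [Finset.sum_Icc_succ_top (by omega)]; linarith [hc (n + 1)]
    push_cast
    nlinarith [mul_le_mul_of_nonneg_left h3 (Nat.cast_nonneg (α := ℝ) n)]

lemma iter_neg (T S : Ω → Ω) (n : ℕ) : iter T S (-(n : ℤ)) = S^[n] := by
  cases n with
  | zero => rfl
  | succ n => rfl

lemma iter_meas {T S : Ω → Ω} (hT : Measurable T) (hS : Measurable S) (k : ℤ) :
    Measurable (iter T S k) := by
  cases k with
  | ofNat n => exact hT.iterate n
  | negSucc n => exact hS.iterate (n + 1)

lemma obsField_le {Ω : Type*} {Y : MeasurableSpace Ω} {m0 : MeasurableSpace Ω}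
    {T S : Ω → Ω} (hT : Measurable T) (hS : Measurable S)
    (hY : Y ≤ m0) (m n : ℤ) : obsField T S Y m n ≤ m0 :=
  iSup₂_le fun k _ => ((iter_meas hT hS k).mono le_rfl hY).comap_le

lemma obsFieldLE_le {Ω : Type*} {Y : MeasurableSpace Ω} {m0 : MeasurableSpace Ω}
    {T S : Ω → Ω} (hT : Measurable T) (hS : Measurable S)
    (hY : Y ≤ m0) (n : ℤ) : obsFieldLE T S Y n ≤ m0 :=
  iSup₂_le fun k _ => ((iter_meas hT hS k).mono le_rfl hY).comap_le

lemma shift_mem {T S : Ω → Ω} (hTS : Function.RightInverse S T) {Y : MeasurableSpace Ω}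
    {v : Ω → U} {k : ℕ} (hv : v ∈ Umn T S Y 0 (k : ℤ)) : v ∘ S^[k] ∈ Un T S Y 0 := by
  refine mem_iUnion₂.2 ⟨-(k : ℤ), by simp, ?_⟩
  have hv' : Measurable[obsField T S Y 0 k] v := hv
  refine @Measurable.comp Ω Ω U _ (obsField T S Y 0 k) _ _ _ hv' ?_
  rw [measurable_iff_comap_le]
  unfold obsField
  simp only [MeasurableSpace.comap_iSup, MeasurableSpace.comap_comp]
  refine iSup₂_le fun j hj => ?_
  obtain ⟨j, rfl⟩ := Int.eq_ofNat_of_zero_le hj.1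
  have hjk : j ≤ k := by exact_mod_cast hj.2
  obtain ⟨d, rfl⟩ := Nat.exists_eq_add_of_le hjk
  have e : iter T S (j : ℤ) ∘ S^[j + d] = iter T S (-(d : ℤ)) := by
    rw [iter_neg, Function.iterate_add]
    funext ω
    exact (hTS.iterate j) _
  rw [e]
  refine le_iSup₂_of_le (-(d : ℤ)) ?_ le_rfl
  constructor <;> push_cast <;> omega

lemma Un_meas {Ω U : Type*} {Y : MeasurableSpace Ω} {m0 : MeasurableSpace Ω} [MeasurableSpace U]
    {T S : Ω → Ω} (hT : Measurable T) (hS : Measurable S)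
    (hY : Y ≤ m0) {w : Ω → U} (hw : w ∈ Un T S Y 0) : Measurable w := by
  obtain ⟨m, _, h⟩ := mem_iUnion₂.1 hw
  exact Measurable.mono h (obsField_le hT hS hY m 0) le_rfl

/-- The tail of the dominating function. -/
def tailFn (Λ : Ω → ℝ) (M : ℝ) : Ω → ℝ := {ω | M < Λ ω}.indicator Λ

lemma tailFn_int {P : Measure Ω} {Λ : Ω → ℝ} (hΛ : Integrable Λ P) (M : ℝ) :
    Integrable (tailFn Λ M) P :=
  hΛ.indicator₀ (nullMeasurableSet_lt aemeasurable_const hΛ.aemeasurable)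

lemma tailFn_tendsto {P : Measure Ω} {Λ : Ω → ℝ} (hΛ : Integrable Λ P) :
    Tendsto (fun M : ℝ => ∫ ω, tailFn Λ M ω ∂P) atTop (𝓝 0) := by
  have h := tendsto_integral_filter_of_dominated_convergence (μ := P) (l := (atTop : Filter ℝ))
    (F := fun M => tailFn Λ M) (f := fun _ => 0) (fun ω => |Λ ω|)
    (Eventually.of_forall fun M => (tailFn_int hΛ M).aestronglyMeasurable)
    (Eventually.of_forall fun M => Eventually.of_forall fun ω => by
      unfold tailFn indicator; split_ifs <;> simp) hΛ.abs
    (Eventually.of_forall fun ω => by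
      refine tendsto_const_nhds.congr' ?_
      filter_upwards [eventually_ge_atTop (Λ ω)] with M hM
      simp [tailFn, indicator, not_lt.2 hM])
  simpa using h

lemma truncLoss_int {P : Measure Ω} {ℓ : U → Ω → ℝ} (hℓ : Measurable fun p : U × Ω => ℓ p.1 p.2)
    {Λ : Ω → ℝ} (hΛ : Integrable Λ P) (hdom : ∀ u ω, |ℓ u ω| ≤ Λ ω) {w : Ω → U}
    (hw : Measurable w) (M : ℝ) :
    Integrable (fun ω => ℓ (w ω) ω) P ∧ Integrable (truncLoss ℓ Λ M w) P := by
  have h1 : Integrable (fun ω => ℓ (w ω) ω) P :=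
    hΛ.mono' (hℓ.comp (hw.prodMk measurable_id)).aestronglyMeasurable
      (Eventually.of_forall fun ω => hdom _ _)
  refine ⟨h1, ?_⟩
  have e : truncLoss ℓ Λ M w = {ω | Λ ω ≤ M}.indicator (fun ω => ℓ (w ω) ω) := by
    funext ω; simp [truncLoss, indicator]
  rw [e]
  exact h1.indicator₀ (nullMeasurableSet_le hΛ.aemeasurable aemeasurable_const)

lemma barLoss_bdd {Ω U : Type*} {Y : MeasurableSpace Ω} {m0 : MeasurableSpace Ω} [MeasurableSpace U]
    {P : Measure Ω} {T S : Ω → Ω}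
    {ℓ : U → Ω → ℝ} {Λ : Ω → ℝ} (hdom : ∀ u ω, |ℓ u ω| ≤ Λ ω) (w : Ω → U) {M : ℝ} (hM : 0 ≤ M) :
    ∀ᵐ ω ∂P, |barLoss P T S Y ℓ Λ M w ω| ≤ 2 * M := by
  have h1 : ∀ ω, |truncLoss ℓ Λ M w ω| ≤ M := by
    intro ω
    unfold truncLoss
    split_ifs with h
    · exact (hdom _ _).trans h
    · simpa using hM
  have h2 := ae_bdd_abs_condExp_of_ae_bdd_abs (μ := P) (m := obsFieldLE T S Y 0) (R := M)
    (f := truncLoss ℓ Λ M w) (Eventually.of_forall h1)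
  filter_upwards [h2] with ω h
  have h' : |(P[truncLoss ℓ Λ M w | obsFieldLE T S Y 0]) ω| ≤ M := h
  unfold barLoss
  have := abs_sub (truncLoss ℓ Λ M w ω) ((P[truncLoss ℓ Λ M w | obsFieldLE T S Y 0]) ω)
  linarith [h1 ω]

lemma barLoss_int {Ω U : Type*} {Y : MeasurableSpace Ω} {m0 : MeasurableSpace Ω} [MeasurableSpace U]
    {P : Measure Ω} {T S : Ω → Ω}
    {ℓ : U → Ω → ℝ} (hℓ : Measurable fun p : U × Ω => ℓ p.1 p.2)
    {Λ : Ω → ℝ} (hΛ : Integrable Λ P) (hdom : ∀ u ω, |ℓ u ω| ≤ Λ ω) {w : Ω → U}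
    (hw : Measurable w) (M : ℝ) : Integrable (barLoss P T S Y ℓ Λ M w) P :=
  (truncLoss_int hℓ hΛ hdom hw M).2.sub integrable_condExp

/-- The lower bound for one loss. -/
lemma loss_lower {Ω U : Type*} {Y : MeasurableSpace Ω} {m0 : MeasurableSpace Ω} [MeasurableSpace U]
    {P : Measure Ω} {T S : Ω → Ω}
    {ℓ : U → Ω → ℝ} (hℓ : Measurable fun p : U × Ω => ℓ p.1 p.2)
    {Λ : Ω → ℝ} (hΛ : Integrable Λ P) (hdom : ∀ u ω, |ℓ u ω| ≤ Λ ω) {w : Ω → U}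
    (hw : Measurable w) (M : ℝ) (g : Ω → ℝ)
    (hg : ∀ᵐ ω ∂P, g ω ≤ (P[lossAt T S ℓ 0 w | obsFieldLE T S Y 0]) ω) :
    ∀ᵐ ω ∂P, barLoss P T S Y ℓ Λ M w ω + g ω -
      ((P[tailFn Λ M | obsFieldLE T S Y 0]) ω + tailFn Λ M ω) ≤ ℓ (w ω) ω := by
  obtain ⟨h1, h2⟩ := truncLoss_int hℓ hΛ hdom hw M
  have hR := tailFn_int hΛ M
  have hpt : ∀ ω, |ℓ (w ω) ω - truncLoss ℓ Λ M w ω| ≤ tailFn Λ M ω := by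
    intro ω
    by_cases h : Λ ω ≤ M
    · simp [truncLoss, tailFn, indicator, h, not_lt.2 h]
    · simpa [truncLoss, tailFn, indicator, h, not_le.1 h] using hdom _ _
  have e : lossAt T S ℓ 0 w = fun ω => ℓ (w ω) ω := rfl
  rw [e] at hg
  have hs := condExp_sub h1 h2 (obsFieldLE T S Y 0)
  have hm := condExp_mono (m := obsFieldLE T S Y 0) (h1.sub h2) hR
    (Eventually.of_forall fun ω => (le_abs_self _).trans (hpt ω))
  filter_upwards [hg, hs, hm] with ω a b c
  have hp := (abs_le.1 (hpt ω)).1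
  rw [b, Pi.sub_apply] at c
  unfold barLoss
  linarith

lemma gstar_int {Ω U : Type*} {Y : MeasurableSpace Ω} {m0 : MeasurableSpace Ω} [MeasurableSpace U]
    {P : Measure Ω} {T S : Ω → Ω}
    (hle : obsFieldLE T S Y 0 ≤ m0) (hm : ∀ w ∈ (Un T S Y 0 : Set (Ω → U)), Measurable w)
    {ℓ : U → Ω → ℝ} (hℓ : Measurable fun p : U × Ω => ℓ p.1 p.2)
    {Λ : Ω → ℝ} (hΛ : Integrable Λ P) (hdom : ∀ u ω, |ℓ u ω| ≤ Λ ω) {w : Ω → U}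
    (hw : w ∈ (Un T S Y 0 : Set (Ω → U))) {g : Ω → ℝ}
    (hg : IsEssInfFam P (Un T S Y 0 : Set (Ω → U))
      (fun v => P[lossAt T S ℓ 0 v | obsFieldLE T S Y 0]) g) : Integrable g P := by
  obtain ⟨hgm, hg1, hg2⟩ := hg
  have hlow : ∀ᵐ ω ∂P, (P[-Λ | obsFieldLE T S Y 0]) ω ≤ g ω := by
    refine hg2 _ (stronglyMeasurable_condExp.measurable.mono hle le_rfl) fun v hv => ?_
    exact condExp_mono hΛ.neg (truncLoss_int hℓ hΛ hdom (hm v hv) 0).1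
      (Eventually.of_forall fun ω => (abs_le.1 (hdom (v ω) ω)).1)
  have i1 : Integrable (P[-Λ | obsFieldLE T S Y 0]) P := integrable_condExp
  have i2 : Integrable (P[lossAt T S ℓ 0 w | obsFieldLE T S Y 0]) P := integrable_condExp
  refine (i1.abs.add i2.abs).mono' hgm.aestronglyMeasurable ?_
  filter_upwards [hlow, hg1 w hw] with ω a b
  rw [Real.norm_eq_abs, abs_le]
  simp only [Pi.add_apply]
  constructor
  · linarith [neg_abs_le ((P[-Λ | obsFieldLE T S Y 0]) ω),
      abs_nonneg ((P[lossAt T S ℓ 0 w | obsFieldLE T S Y 0]) ω)]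
  · linarith [le_abs_self ((P[lossAt T S ℓ 0 w | obsFieldLE T S Y 0]) ω),
      abs_nonneg ((P[-Λ | obsFieldLE T S Y 0]) ω)]

/-- Correlations are controlled by the essential supremum. -/
lemma corr_bound {Ω U : Type*} {Y : MeasurableSpace Ω} {m0 : MeasurableSpace Ω} [MeasurableSpace U]
    {P : Measure Ω} [IsProbabilityMeasure P] {T S : Ω → Ω}
    (hle : obsFieldLE T S Y 0 ≤ m0) (hS : MeasurePreserving S P P)
    (hm : ∀ w ∈ (Un T S Y 0 : Set (Ω → U)), Measurable w)
    {ℓ : U → Ω → ℝ} (hℓ : Measurable fun p : U × Ω => ℓ p.1 p.2)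
    {Λ : Ω → ℝ} (hΛ : Integrable Λ P) (hdom : ∀ u ω, |ℓ u ω| ≤ Λ ω)
    {w₀ : Ω → U} (hw₀ : w₀ ∈ (Un T S Y 0 : Set (Ω → U))) {M : ℝ} (hM : 0 ≤ M) (k : ℕ) {g : Ω → ℝ}
    (hg : IsEssSupFam P ((Un T S Y 0 : Set (Ω → U)) ×ˢ (Un T S Y 0 : Set (Ω → U)))
        (fun p ω =>
          |(P[(fun ω' => barLoss P T S Y ℓ Λ M p.1 (S^[k] ω') *
                barLoss P T S Y ℓ Λ M p.2 ω') | obsFieldLE T S Y 0]) ω|) g) :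
    Integrable g P ∧ 0 ≤ ∫ ω, g ω ∂P ∧ ∫ ω, g ω ∂P ≤ (2 * M) ^ 2 ∧
    ∀ w ∈ (Un T S Y 0 : Set (Ω → U)), ∀ w' ∈ (Un T S Y 0 : Set (Ω → U)),
      ∫ ω, barLoss P T S Y ℓ Λ M w (S^[k] ω) * barLoss P T S Y ℓ Λ M w' ω ∂P ≤ ∫ ω, g ω ∂P := by
  obtain ⟨hgm, hg1, hg2⟩ := hg
  have hup : ∀ᵐ ω ∂P, g ω ≤ (2 * M) ^ 2 := by
    refine hg2 (fun _ => (2 * M) ^ 2) measurable_const fun p hp => ?_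
    have hb : ∀ᵐ ω ∂P, |barLoss P T S Y ℓ Λ M p.1 (S^[k] ω) *
        barLoss P T S Y ℓ Λ M p.2 ω| ≤ (2 * M) ^ 2 := by
      filter_upwards [(hS.iterate k).quasiMeasurePreserving.ae
        (barLoss_bdd (P := P) (T := T) (S := S) (Y := Y) hdom p.1 hM),
        barLoss_bdd (P := P) (T := T) (S := S) (Y := Y) hdom p.2 hM] with ω a b
      rw [abs_mul, sq]
      exact mul_le_mul a b (abs_nonneg _) (by positivity)
    exact ae_bdd_abs_condExp_of_ae_bdd_abs hb
  have hlow : ∀ᵐ ω ∂P, 0 ≤ g ω := by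
    filter_upwards [hg1 (w₀, w₀) ⟨hw₀, hw₀⟩] with ω h
    exact (abs_nonneg _).trans h
  have hgi : Integrable g P := by
    refine (integrable_const ((2 * M) ^ 2)).mono' hgm.aestronglyMeasurable ?_
    filter_upwards [hup, hlow] with ω a b
    rwa [Real.norm_eq_abs, abs_of_nonneg b]
  refine ⟨hgi, integral_nonneg_of_ae hlow, ?_, fun w hw w' hw' => ?_⟩
  · have := integral_mono_ae hgi (integrable_const ((2 * M) ^ 2)) hup
    simpa using this
  · rw [← integral_condExp hle]
    refine integral_mono_ae integrable_condExp hgi ?_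
    filter_upwards [hg1 (w, w') ⟨hw, hw'⟩] with ω h
    exact (le_abs_self _).trans h

lemma sum_Icc_range {A : Type*} [AddCommMonoid A] (F : ℕ → A) (n : ℕ) :
    ∑ k ∈ Finset.Icc 1 n, F k = ∑ i ∈ Finset.range n, F (i + 1) := by
  induction n with
  | zero => simp
  | succ n ih => rw [Finset.sum_Icc_succ_top (by omega), Finset.sum_range_succ, ih]

lemma markov {P : Measure Ω} {f : Ω → ℝ} (h0 : ∀ ω, 0 ≤ f ω) (hf : Integrable f P) {ε : ℝ}
    (hε : 0 < ε) : P.real {ω | ε ≤ f ω} ≤ ε⁻¹ * ∫ ω, f ω ∂P := by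
  rw [← div_eq_inv_mul, le_div_iff₀' hε]
  exact mul_meas_ge_le_integral_of_nonneg (Eventually.of_forall h0) hf ε

set_option maxHeartbeats 1000000 in
theorem main_aux
    {Ω U : Type*} (Y : MeasurableSpace Ω) {m0 : MeasurableSpace Ω} [MeasurableSpace U]
    (P : Measure Ω) [IsProbabilityMeasure P]
    (T S : Ω → Ω) (hT : Ergodic T P) (hS : MeasurePreserving S P P)
    (hST : Function.LeftInverse S T) (hTS : Function.RightInverse S T)
    (ℓ : U → Ω → ℝ) (hℓ : Measurable fun p : U × Ω => ℓ p.1 p.2)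
    (Λ : Ω → ℝ) (hΛ : Integrable Λ P) (hdom : ∀ u ω, |ℓ u ω| ≤ Λ ω)
    (hY : Y ≤ m0)
    (hmix : UniformCondMixing P T S Y ℓ Λ)
    (gstar : Ω → ℝ)
    (hgstar : IsEssInfFam P (Un T S Y 0 : Set (Ω → U))
      (fun v => P[lossAt T S ℓ 0 v | obsFieldLE T S Y 0]) gstar) :
    ∀ u : ℕ → Ω → U, Admissible T S Y u → ∀ ε : ℝ, 0 < ε →
      Tendsto (fun n : ℕ =>
          P {ω | avgLoss T S ℓ u n ω - ∫ ω', gstar ω' ∂P ≤ -ε})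
        atTop (𝓝 0) := by
  intro u hu ε hε
  obtain ⟨G, hG, hGlim⟩ := hmix
  have hTmp := hT.toMeasurePreserving
  have hTm := hTmp.measurable
  have hSm := hS.measurable
  have hle := obsFieldLE_le hTm hSm hY 0
  have hmeas : ∀ w ∈ (Un T S Y 0 : Set (Ω → U)), Measurable w := fun w hw =>
    Un_meas hTm hSm hY hw
  let v : ℕ → Ω → U := fun k => u (max k 1) ∘ S^[max k 1]
  have hv : ∀ k, v k ∈ (Un T S Y 0 : Set (Ω → U)) := fun k =>
    shift_mem hTS (hu (max k 1) (le_max_right _ _))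
  have hvk : ∀ k : ℕ, 1 ≤ k → ∀ ω, lossAt T S ℓ (k : ℤ) (u k) ω = ℓ (v k (T^[k] ω)) (T^[k] ω) := by
    intro k hk ω
    have : v k (T^[k] ω) = u k ω := by
      simp only [v, max_eq_left hk, Function.comp]
      rw [hST.iterate k]
    rw [this]; rfl
  have hgi : Integrable gstar P := gstar_int hle hmeas hℓ hΛ hdom (hv 0) hgstar
  set Lst := ∫ ω', gstar ω' ∂P with hLst
  have hgTi : Integrable (fun ω => gstar (T ω)) P := hTmp.integrable_comp_of_integrable hgi
  have hgT : ∫ ω, gstar (T ω) ∂P = Lst := mp_integral hTmp hgi.aestronglyMeasurable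
  have hmet := met1 hT hgTi
  rw [hgT] at hmet
  set B : ℕ → Ω → ℝ := fun n ω => (n : ℝ)⁻¹ * ∑ i ∈ Finset.range n, gstar (T (T^[i] ω)) - Lst
    with hB
  have hBi : ∀ n, Integrable (B n) P := fun n => (avg_int hTmp hgTi n).sub (integrable_const _)
  set a : ℝ → ℕ → ℝ := fun M n => ∫ ω, (n : ℝ)⁻¹ * ∑ k ∈ Finset.Icc 1 n, G M k ω ∂P with ha
  have hcorr := fun (M : ℝ) (hM : 0 ≤ M) (k : ℕ) =>
    corr_bound hle hS hmeas hℓ hΛ hdom (hv 0) hM k (hG M k)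
  have hae : ∀ M, 0 ≤ M → ∀ n, a M n = (n : ℝ)⁻¹ * ∑ k ∈ Finset.Icc 1 n, ∫ ω, G M k ω ∂P := by
    intro M hM n
    simp only [ha]
    rw [integral_const_mul, integral_finsetSum _ fun k _ => (hcorr M hM k).1]
  -- the main estimate
  have core : ∀ M, 0 ≤ M → ∀ n : ℕ, 0 < n →
      P.real {ω | avgLoss T S ℓ u n ω - Lst ≤ -ε} ≤
        ((ε / 3) ^ 2)⁻¹ * ((2 * M) ^ 2 * (n : ℝ)⁻¹ + 2 * a M n) +
        (ε / 3)⁻¹ * ∫ ω, |B n ω| ∂P + (ε / 3)⁻¹ * (2 * ∫ ω, tailFn Λ M ω ∂P) := by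
    intro M hM n hn
    have hn0 : (n : ℝ) ≠ 0 := by positivity
    have hε3 : 0 < ε / 3 := by linarith
    set b : ℕ → Ω → ℝ := fun k => barLoss P T S Y ℓ Λ M (v k) with hb
    have hbi : ∀ k, Integrable (b k) P := fun k => barLoss_int hℓ hΛ hdom (hmeas _ (hv k)) M
    have hbb : ∀ k, ∀ᵐ ω ∂P, |b k ω| ≤ 2 * M := fun k => barLoss_bdd hdom (v k) hM
    set X : ℕ → Ω → ℝ := fun k ω => b k (T^[k] ω) with hX
    have hXi : ∀ k, Integrable (X k) P := fun k =>
      (hTmp.iterate k).integrable_comp_of_integrable (hbi k)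
    have hXb : ∀ k, ∀ᵐ ω ∂P, |X k ω| ≤ 2 * M := fun k =>
      (hTmp.iterate k).quasiMeasurePreserving.ae (hbb k)
    have hXX : ∀ j k, 1 ≤ j → j < k → ∫ ω, X j ω * X k ω ∂P ≤ ∫ ω, G M (k - j) ω ∂P := by
      intro j k _ hjk
      have e : ∀ ω, X j ω * X k ω =
          (fun ω' => b j (S^[k - j] ω') * b k ω') (T^[k] ω) := by
        intro ω
        have : S^[k - j] (T^[k] ω) = T^[j] ω := by
          conv_lhs => rw [show k = (k - j) + j by omega, Function.iterate_add_apply T]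
          rw [show k - j + j - j = k - j by omega]
          exact hST.iterate (k - j) _
        simp only [hX, this]
      simp only [e]
      rw [mp_integral (f := fun ω' => b j (S^[k - j] ω') * b k ω') (hTmp.iterate k)
        (((hS.iterate _).integrable_comp_of_integrable (hbi j)).aestronglyMeasurable.mul
          (hbi k).aestronglyMeasurable)]
      exact (hcorr M hM (k - j)).2.2.2 _ (hv j) _ (hv k)
    have hsm := second_moment X (2 * M) (fun k => (hXi k).aestronglyMeasurable) hXb
      (fun k => ∫ ω, G M k ω ∂P) (fun k => (hcorr M hM k).2.1) hXX n
    set A : Ω → ℝ := fun ω => (n : ℝ)⁻¹ * ∑ k ∈ Finset.Icc 1 n, X k ω with hA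
    have hA2 : ∫ ω, A ω ^ 2 ∂P ≤ (2 * M) ^ 2 * (n : ℝ)⁻¹ + 2 * a M n := by
      simp only [hA, mul_pow]
      rw [integral_const_mul, hae M hM n]
      calc _ ≤ ((n : ℝ)⁻¹) ^ 2 * (n * (2 * M) ^ 2 +
            2 * (n * ∑ i ∈ Finset.Icc 1 n, ∫ ω, G M i ω ∂P)) := by gcongr
        _ = _ := by field_simp
    have hA2i : Integrable (fun ω => A ω ^ 2) P := by
      have h2 : ∀ k, MemLp (X k) 2 P := fun k =>
        MemLp.of_bound (hXi k).aestronglyMeasurable (2 * M) (by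
          filter_upwards [hXb k] with ω h
          rw [Real.norm_eq_abs]
          exact h)
      have h3 : MemLp (fun ω => ∑ k ∈ Finset.Icc 1 n, X k ω) 2 P :=
        memLp_finsetSum _ fun k _ => h2 k
      exact (h3.const_mul (n : ℝ)⁻¹).integrable_sq
    set D : Ω → ℝ := fun ω => (P[tailFn Λ M | obsFieldLE T S Y 0]) ω + tailFn Λ M ω with hD
    have hRi := tailFn_int hΛ M
    have hR0 : ∀ ω, 0 ≤ tailFn Λ M ω := fun ω => by
      have := (abs_nonneg _).trans (hdom (u 0 ω) ω)
      exact indicator_nonneg (fun ω _ => (abs_nonneg _).trans (hdom (u 0 ω) ω)) ω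
    have hDi : Integrable D P := integrable_condExp.add hRi
    have hD1 : ∫ ω, |D ω| ∂P = 2 * ∫ ω, tailFn Λ M ω ∂P := by
      have : ∫ ω, |D ω| ∂P = ∫ ω, D ω ∂P := by
        refine integral_congr_ae ?_
        filter_upwards [condExp_nonneg (m := obsFieldLE T S Y 0) (μ := P)
          (Eventually.of_forall hR0)] with ω h
        exact abs_of_nonneg (add_nonneg h (hR0 ω))
      rw [this, integral_add integrable_condExp hRi, integral_condExp hle]
      ring
    have hDTi : Integrable (fun ω => D (T ω)) P := hTmp.integrable_comp_of_integrable hDi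
    set E : Ω → ℝ := fun ω => (n : ℝ)⁻¹ * ∑ i ∈ Finset.range n, D (T (T^[i] ω)) with hE
    have hEi : Integrable E P := avg_int hTmp hDTi n
    have hE1 : ∫ ω, |E ω| ∂P ≤ 2 * ∫ ω, tailFn Λ M ω ∂P := by
      refine (avg_L1 hTmp hDTi n).trans (le_of_eq ?_)
      rw [← hD1]
      exact mp_integral (f := fun ω => |D ω|) hTmp hDi.abs.aestronglyMeasurable
    have hlow : ∀ᵐ ω ∂P, ∀ k, b k (T^[k] ω) + gstar (T^[k] ω) - D (T^[k] ω) ≤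
        ℓ (v k (T^[k] ω)) (T^[k] ω) := by
      refine ae_all_iff.2 fun k => (hTmp.iterate k).quasiMeasurePreserving.ae
        (p := fun x => b k x + gstar x - D x ≤ ℓ (v k x) x) ?_
      exact loss_lower hℓ hΛ hdom (hmeas _ (hv k)) M gstar (hgstar.2.1 _ (hv k))
    have hincl : ∀ᵐ ω ∂P, ω ∈ {ω | avgLoss T S ℓ u n ω - Lst ≤ -ε} →
        ω ∈ ({ω | (ε / 3) ^ 2 ≤ A ω ^ 2} ∪ {ω | ε / 3 ≤ |B n ω|}) ∪ {ω | ε / 3 ≤ |E ω|} := by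
      filter_upwards [hlow] with ω hω hev
      by_contra hcon
      simp only [mem_union, mem_ofPred_eq, not_or, not_le] at hcon hev
      obtain ⟨⟨h1, h2⟩, h3⟩ := hcon
      have h1' := (abs_lt.1 ((sq_lt_sq.1 h1).trans_eq (abs_of_pos hε3))).1
      have h2' := (abs_lt.1 h2).1
      have h3' := (abs_lt.1 h3).2
      have hge : A ω + (B n ω + Lst) - E ω ≤ avgLoss T S ℓ u n ω := by
        have e1 : ∑ i ∈ Finset.range n, gstar (T (T^[i] ω)) =
            ∑ k ∈ Finset.Icc 1 n, gstar (T^[k] ω) := by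
          rw [sum_Icc_range]
          simp only [Function.iterate_succ_apply']
        have e2 : ∑ i ∈ Finset.range n, D (T (T^[i] ω)) =
            ∑ k ∈ Finset.Icc 1 n, D (T^[k] ω) := by
          rw [sum_Icc_range]
          simp only [Function.iterate_succ_apply']
        simp only [hA, hB, hE, sub_add_cancel, avgLoss]
        rw [e1, e2, ← mul_add, ← mul_sub, ← Finset.sum_add_distrib, ← Finset.sum_sub_distrib]
        refine mul_le_mul_of_nonneg_left (Finset.sum_le_sum fun k hk => ?_) (by positivity)
        rw [hvk k (Finset.mem_Icc.1 hk).1]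
        exact hω k
      linarith
    have hmono : P.real {ω | avgLoss T S ℓ u n ω - Lst ≤ -ε} ≤
        P.real (({ω | (ε / 3) ^ 2 ≤ A ω ^ 2} ∪ {ω | ε / 3 ≤ |B n ω|}) ∪ {ω | ε / 3 ≤ |E ω|}) :=
      ENNReal.toReal_mono (measure_ne_top _ _) (measure_mono_ae hincl)
    have hu1 := measureReal_union_le (μ := P)
      ({ω | (ε / 3) ^ 2 ≤ A ω ^ 2} ∪ {ω | ε / 3 ≤ |B n ω|}) {ω | ε / 3 ≤ |E ω|}
    have hu2 := measureReal_union_le (μ := P)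
      {ω | (ε / 3) ^ 2 ≤ A ω ^ 2} {ω | ε / 3 ≤ |B n ω|}
    have m1 := markov (fun ω => sq_nonneg (A ω)) hA2i (ε := (ε / 3) ^ 2) (by positivity)
    have m2 := markov (fun ω => abs_nonneg (B n ω)) (hBi n).abs hε3
    have m3 := markov (fun ω => abs_nonneg (E ω)) hEi.abs hε3
    have m1' := mul_le_mul_of_nonneg_left hA2 (show 0 ≤ ((ε / 3) ^ 2)⁻¹ by positivity)
    have m3' := mul_le_mul_of_nonneg_left hE1 (show 0 ≤ (ε / 3)⁻¹ by positivity)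
    linarith
  -- conclusion
  have hreal : Tendsto (fun n : ℕ => P.real {ω | avgLoss T S ℓ u n ω - Lst ≤ -ε})
      atTop (𝓝 0) := by
    rw [tendsto_order]
    refine ⟨fun x hx => Eventually.of_forall fun n => hx.trans_le measureReal_nonneg,
      fun δ hδ => ?_⟩
    have t1 : Tendsto (fun M : ℝ => ((ε / 3) ^ 2)⁻¹ * (2 * limsup (a M) atTop) +
        (ε / 3)⁻¹ * (2 * ∫ ω, tailFn Λ M ω ∂P)) atTop (𝓝 0) := by
      have := ((hGlim.const_mul 2).const_mul ((ε / 3) ^ 2)⁻¹).add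
        (((tailFn_tendsto hΛ).const_mul 2).const_mul (ε / 3)⁻¹)
      simpa using this
    obtain ⟨M, hM1, hM⟩ := ((t1.eventually_lt_const (show 0 < δ / 2 by linarith)).and
      (eventually_ge_atTop 0)).exists
    set q := ((ε / 3) ^ 2)⁻¹ with hq
    have hq0 : 0 < q := by positivity
    have hbdd : IsBoundedUnder (· ≤ ·) atTop (a M) := by
      refine isBoundedUnder_of ⟨(2 * M) ^ 2, fun n => ?_⟩
      show a M n ≤ _
      rw [hae M hM n]
      rcases Nat.eq_zero_or_pos n with rfl | hn
      · simp; positivity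
      · have hn' : (0 : ℝ) < n := by positivity
        rw [inv_mul_le_iff₀ hn']
        calc _ ≤ ∑ k ∈ Finset.Icc 1 n, (2 * M) ^ 2 :=
              Finset.sum_le_sum fun k _ => (hcorr M hM k).2.2.1
          _ = _ := by simp
    have hev := eventually_lt_of_limsup_lt
      (show limsup (a M) atTop < limsup (a M) atTop + δ / (8 * q) by
        have : 0 < δ / (8 * q) := by positivity
        linarith) hbdd
    have t2 : Tendsto (fun n : ℕ => q * ((2 * M) ^ 2 * (n : ℝ)⁻¹) + (ε / 3)⁻¹ * ∫ ω, |B n ω| ∂P)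
        atTop (𝓝 0) := by
      have := (((tendsto_inv_atTop_nhds_zero_nat (𝕜 := ℝ)).const_mul ((2 * M) ^ 2)).const_mul q).add
        (hmet.const_mul (ε / 3)⁻¹)
      simpa using this
    filter_upwards [hev, t2.eventually_lt_const (show 0 < δ / 4 by linarith),
      eventually_gt_atTop 0] with n h1 h2 h3
    have h4 := core M hM n h3
    have h5 : q * (2 * a M n) ≤ q * (2 * limsup (a M) atTop) + δ / 4 := by
      have := mul_le_mul_of_nonneg_left h1.le (show 0 ≤ q * 2 by positivity)
      have e : q * 2 * (limsup (a M) atTop + δ / (8 * q)) =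
        q * (2 * limsup (a M) atTop) + δ / 4 := by field_simp; ring
      rw [e] at this
      linarith
    rw [mul_add] at h4
    linarith
  have h := ENNReal.tendsto_ofReal hreal
  simpa using h

/-- Corollary 4.6: under the uniform conditional mixing assumption, for
every admissible strategy `u` and every `ε > 0`, `P[L_T(u) − L⋆ ≤ −ε] → 0` as `T → ∞`. -/
theorem statement18
    {Ω U : Type*} [m0 : MeasurableSpace Ω] [MeasurableSpace U]
    (P : Measure Ω) [IsProbabilityMeasure P]
    (T S : Ω → Ω) (hT : Ergodic T P) (hS : MeasurePreserving S P P)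
    (hST : Function.LeftInverse S T) (hTS : Function.RightInverse S T)
    (ℓ : U → Ω → ℝ) (hℓ : Measurable fun p : U × Ω => ℓ p.1 p.2)
    (Λ : Ω → ℝ) (hΛ : Integrable Λ P) (hdom : ∀ u ω, |ℓ u ω| ≤ Λ ω)
    (Y : MeasurableSpace Ω) (hY : Y ≤ m0)
    (hmix : UniformCondMixing P T S Y ℓ Λ)
    (gstar : Ω → ℝ)
    (hgstar : IsEssInfFam P (Un T S Y 0 : Set (Ω → U))
      (fun v => P[lossAt T S ℓ 0 v | obsFieldLE T S Y 0]) gstar) :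
    ∀ u : ℕ → Ω → U, Admissible T S Y u → ∀ ε : ℝ, 0 < ε →
      Tendsto (fun n : ℕ =>
          P {ω | avgLoss T S ℓ u n ω - ∫ ω', gstar ω' ∂P ≤ -ε})
        atTop (𝓝 0) := by
  exact main_aux Y P T S hT hS hST hTS ℓ hℓ Λ hΛ hdom hY hmix gstar hgstar

end ErgodicDecisions
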